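/- There exists ε₀ ∈ (0,1] such that for every ε ∈ (0, ε₀], every unit vector n ∈ ℝ³ and every symmetric matrix H ∈ ℝ^{3×3}, one has tr((H L_{n,ε}^{−1})²) ≥ (1/2)‖H‖², where L_{n,ε} := (1+ε)² n⊗n + (1+ε)^{−1}(I − n⊗n) and ‖·‖ is the Frobenius norm. -/

import Mathlib

open Matrix

noncomputable section

/-- Frobenius norm of a real `3 × 3` matrix. -/
def frob (F : Matrix (Fin 3) (Fin 3) ℝ) : ℝ :=
  Real.sqrt (∑ i, ∑ j, (F i j) ^ 2)

/-- `L_{n,ε} = (1+ε)² n⊗n + (1+ε)⁻¹ (I - n⊗n)`. -/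
def Lne (ε : ℝ) (n : Fin 3 → ℝ) : Matrix (Fin 3) (Fin 3) ℝ :=
  (1 + ε) ^ 2 • Matrix.vecMulVec n n + (1 + ε)⁻¹ • (1 - Matrix.vecMulVec n n)

lemma frob_sq (F : Matrix (Fin 3) (Fin 3) ℝ) : frob F ^ 2 = ∑ i, ∑ j, F i j ^ 2 :=
  Real.sq_sqrt (by positivity)

lemma mulVec_dotProduct_self_le_frob_sq (F : Matrix (Fin 3) (Fin 3) ℝ) {n : Fin 3 → ℝ}
    (hn : ∑ i, n i ^ 2 = 1) : (F *ᵥ n) ⬝ᵥ (F *ᵥ n) ≤ frob F ^ 2 := by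
  rw [frob_sq]
  refine Finset.sum_le_sum fun i _ => ?_
  have h := Finset.sum_mul_sq_le_sq_mul_sq Finset.univ (F i) n
  rw [hn, mul_one] at h
  rw [← sq]
  exact h

lemma Lne_inv {ε : ℝ} (hε : 0 < ε) {n : Fin 3 → ℝ} (hn : n ⬝ᵥ n = 1) :
    (Lne ε n)⁻¹ =
      (1 + ε) • (1 : Matrix (Fin 3) (Fin 3) ℝ)
        - ((1 + ε) - ((1 + ε) ^ 2)⁻¹) • vecMulVec n n := by
  have h0 : 1 + ε ≠ 0 := by positivity
  have hN : vecMulVec n n * vecMulVec n n = vecMulVec n n := by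
    rw [vecMulVec_mul_vecMulVec, hn, one_smul]
  refine inv_eq_right_inv ?_
  unfold Lne
  generalize vecMulVec n n = N at hN ⊢
  simp only [mul_sub, add_mul, sub_mul, smul_mul_assoc, mul_smul_comm, hN, mul_one, one_mul]
  match_scalars <;> field_simp
  ring

lemma trace_sq_mul_smul_one_sub {H : Matrix (Fin 3) (Fin 3) ℝ} (hH : H.IsSymm)
    (n : Fin 3 → ℝ) (b d : ℝ) :
    trace ((H * (b • (1 : Matrix (Fin 3) (Fin 3) ℝ) - d • vecMulVec n n)) ^ 2) =
      b ^ 2 * frob H ^ 2 - 2 * b * d * ((H *ᵥ n) ⬝ᵥ (H *ᵥ n))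
        + d ^ 2 * (n ⬝ᵥ (H *ᵥ n)) ^ 2 := by
  have hHH : trace (H * H) = frob H ^ 2 := by
    rw [frob_sq, trace]
    refine Finset.sum_congr rfl fun i _ => ?_
    rw [diag_apply, mul_apply]
    refine Finset.sum_congr rfl fun j _ => ?_
    rw [hH.apply, sq]
  have hHn : (H *ᵥ (H *ᵥ n)) ⬝ᵥ n = (H *ᵥ n) ⬝ᵥ (H *ᵥ n) := by
    rw [dotProduct_comm, dotProduct_mulVec, ← mulVec_transpose, hH.eq]
  have hHN : trace (vecMulVec (H *ᵥ n) n * H) = (H *ᵥ n) ⬝ᵥ (H *ᵥ n) := by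
    rw [trace_mul_comm, mul_vecMulVec, trace_vecMulVec, hHn]
  rw [sq]
  simp only [mul_sub, sub_mul, mul_smul_comm, smul_mul_assoc, mul_one, mul_vecMulVec H,
    vecMulVec_mul_vecMulVec, trace_sub, trace_smul, smul_eq_mul, vecMulVec_smul]
  rw [hHH, hHN, trace_vecMulVec, trace_vecMulVec, hHn, dotProduct_comm (H *ᵥ n) n]
  ring

/-- there exists `ε₀ ∈ (0,1]` such that for every `ε ∈ (0,ε₀]`, every unit
vector `n ∈ ℝ³` and every symmetric `H ∈ ℝ^{3×3}`, `tr((H L_{n,ε}⁻¹)²) ≥ (1/2)‖H‖²`. -/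
theorem trace_sq_lower_bound :
    ∃ ε₀ : ℝ, 0 < ε₀ ∧ ε₀ ≤ 1 ∧ ∀ ε : ℝ, 0 < ε → ε ≤ ε₀ →
      ∀ n : Fin 3 → ℝ, (∑ i, (n i) ^ 2 = 1) →
        ∀ H : Matrix (Fin 3) (Fin 3) ℝ, H.IsSymm →
          1 / 2 * (frob H) ^ 2 ≤ Matrix.trace ((H * (Lne ε n)⁻¹) ^ 2) := by
  refine ⟨1 / 10, by norm_num, by norm_num, fun ε hε hε' n hn H hH => ?_⟩
  have hnn : n ⬝ᵥ n = 1 := by simpa only [dotProduct, ← sq] using hn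
  rw [Lne_inv hε hnn, trace_sq_mul_smul_one_sub hH]
  have hF := mulVec_dotProduct_self_le_frob_sq H hn
  set d : ℝ := (1 + ε) - ((1 + ε) ^ 2)⁻¹ with hd_def
  have hd : 0 ≤ d := by
    have : ((1 + ε) ^ 2)⁻¹ ≤ 1 := inv_le_one_of_one_le₀ (by nlinarith)
    linarith
  have hbd : 1 / 2 ≤ (1 + ε) ^ 2 - 2 * (1 + ε) * d := by
    have h : (1 + ε) ^ 2 - 2 * (1 + ε) * d = 2 * (1 + ε)⁻¹ - (1 + ε) ^ 2 := by
      rw [hd_def]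
      field_simp
      ring
    have h' : (1 + 1 / 10 : ℝ)⁻¹ ≤ (1 + ε)⁻¹ := by gcongr
    rw [h]
    norm_num at h'
    nlinarith
  have h1 := mul_le_mul_of_nonneg_left hF (by positivity : 0 ≤ 2 * (1 + ε) * d)
  have h2 := mul_le_mul_of_nonneg_right hbd (sq_nonneg (frob H))
  have h3 : 0 ≤ d ^ 2 * (n ⬝ᵥ (H *ᵥ n)) ^ 2 := by positivity
  linarith
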